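/- Let s and t be integers with 3 ≤ s < t, and let u, v, w be nonnegative integers satisfying u + v + w = 2^t − 4 and (2^s+1)·u + (2^(s−1)+1)·v + w = 4·(2^t − 1). Then the multinomial coefficient (2^t−4)! / (u!·v!·w!) is odd if and only if u = 0, or u = 2^i for some i with 2 ≤ i ≤ t − s, or u = 2^(t−s+1) + 2^j for some j with 2 ≤ j ≤ t − s. -/

import Mathlib

section ChooseParity

theorem Nat.odd_choose_iff_mod_two_div_two (n k : ℕ) :
    Odd (n.choose k) ↔ Odd ((n % 2).choose (k % 2)) ∧ Odd ((n / 2).choose (k / 2)) := by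
  rw [← Nat.odd_mul]
  have h := Choose.choose_modEq_choose_mod_mul_choose_div_nat (p := 2) (n := n) (k := k)
  rw [Nat.odd_iff, Nat.odd_iff, h]

theorem Nat.odd_choose_two_mul_two_mul (n k : ℕ) :
    Odd ((2 * n).choose (2 * k)) ↔ Odd (n.choose k) := by
  rw [Nat.odd_choose_iff_mod_two_div_two]
  simp

theorem Nat.odd_choose_two_mul_add_one_two_mul (n k : ℕ) :
    Odd ((2 * n + 1).choose (2 * k)) ↔ Odd (n.choose k) := by
  rw [Nat.odd_choose_iff_mod_two_div_two]
  simp [show (2 * n + 1) / 2 = n by omega]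

theorem Nat.odd_choose_two_mul_add_one_two_mul_add_one (n k : ℕ) :
    Odd ((2 * n + 1).choose (2 * k + 1)) ↔ Odd (n.choose k) := by
  rw [Nat.odd_choose_iff_mod_two_div_two]
  simp [show (2 * n + 1) / 2 = n by omega, show (2 * k + 1) / 2 = k by omega]

theorem Nat.not_odd_choose_two_mul_two_mul_add_one (n k : ℕ) :
    ¬ Odd ((2 * n).choose (2 * k + 1)) := by
  rw [Nat.odd_choose_iff_mod_two_div_two]
  simp

theorem Nat.odd_choose_two_pow_sub_one (a x n : ℕ) (hn : n + 1 = 2 ^ a) (hx : x ≤ n) :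
    Odd (n.choose x) := by
  induction a generalizing x n with
  | zero =>
    obtain rfl : n = 0 := by simpa using hn
    obtain rfl : x = 0 := by omega
    simp
  | succ a ih =>
    rw [pow_succ] at hn
    obtain ⟨n, rfl⟩ : ∃ l, n = 2 * l + 1 := ⟨2 ^ a - 1, by have := Nat.two_pow_pos a; omega⟩
    obtain ⟨x, rfl | rfl⟩ := Nat.even_or_odd' x
    · rw [Nat.odd_choose_two_mul_add_one_two_mul]
      exact ih x n (by omega) (by omega)
    · rw [Nat.odd_choose_two_mul_add_one_two_mul_add_one]
      exact ih x n (by omega) (by omega)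

theorem Nat.odd_choose_two_pow_sub_four_iff (t x : ℕ) (ht : 2 ≤ t) (hx : x ≤ 2 ^ t - 4) :
    Odd ((2 ^ t - 4).choose x) ↔ 4 ∣ x := by
  obtain ⟨a, rfl⟩ := Nat.exists_eq_add_of_le' ht
  have ha := Nat.two_pow_pos a
  obtain ⟨n, hn⟩ : ∃ n, n + 1 = 2 ^ a := ⟨2 ^ a - 1, by omega⟩
  have hN : 2 ^ (a + 2) - 4 = 2 * (2 * n) := by rw [pow_add]; omega
  rw [hN] at hx ⊢
  obtain ⟨x, rfl | rfl⟩ := Nat.even_or_odd' x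
  · rw [Nat.odd_choose_two_mul_two_mul]
    obtain ⟨x, rfl | rfl⟩ := Nat.even_or_odd' x
    · rw [Nat.odd_choose_two_mul_two_mul]
      exact iff_of_true (Nat.odd_choose_two_pow_sub_one a x n hn (by omega)) (by omega)
    · exact iff_of_false (Nat.not_odd_choose_two_mul_two_mul_add_one _ _) (by omega)
  · exact iff_of_false (Nat.not_odd_choose_two_mul_two_mul_add_one _ _) (by omega)

theorem Nat.odd_choose_iff_of_two_mul_add_add_one_eq (k u v : ℕ) (h : 2 * u + v + 1 = 3 * 2 ^ k) :
    Odd ((u + v).choose u) ↔ u = 0 ∨ u = 2 ^ k := by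
  induction k generalizing u v with
  | zero =>
    obtain ⟨rfl, rfl⟩ | ⟨rfl, rfl⟩ : (u = 0 ∧ v = 2) ∨ (u = 1 ∧ v = 0) := by omega
    all_goals simp
  | succ k ih =>
    rw [pow_succ] at h ⊢
    obtain ⟨v, rfl⟩ : ∃ l, v = 2 * l + 1 := ⟨v / 2, by omega⟩
    obtain ⟨u, rfl | rfl⟩ := Nat.even_or_odd' u
    · rw [show 2 * u + (2 * v + 1) = 2 * (u + v) + 1 by ring,
        Nat.odd_choose_two_mul_add_one_two_mul, ih u v (by omega)]
      omega
    · rw [show 2 * u + 1 + (2 * v + 1) = 2 * (u + v + 1) by ring]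
      exact iff_of_false (Nat.not_odd_choose_two_mul_two_mul_add_one _ _) (by omega)

theorem Nat.odd_choose_iff_of_two_mul_add_eq (m u v : ℕ) (h : 2 * u + v = 3 * 2 ^ m) :
    Odd ((u + v).choose u) ↔
      u = 0 ∨ (∃ i < m, u = 2 ^ i) ∨ ∃ j < m, u = 2 ^ m + 2 ^ j := by
  induction m generalizing u v with
  | zero =>
    obtain ⟨rfl, rfl⟩ | ⟨rfl, rfl⟩ : (u = 0 ∧ v = 3) ∨ (u = 1 ∧ v = 1) := by omega
    · simp
    · simp [Nat.odd_iff]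
  | succ m ih =>
    rw [pow_succ] at h ⊢
    obtain ⟨v, rfl⟩ : ∃ l, v = 2 * l := ⟨v / 2, by omega⟩
    simp only [Nat.exists_lt_succ_left, pow_zero, pow_succ]
    obtain ⟨u, rfl | rfl⟩ := Nat.even_or_odd' u
    · have pow_iff (i : ℕ) : 2 * u = 2 ^ i * 2 ↔ u = 2 ^ i := by omega
      have add_iff (j : ℕ) : 2 * u = 2 ^ m * 2 + 2 ^ j * 2 ↔ u = 2 ^ m + 2 ^ j := by omega
      have ne_one : 2 * u ≠ 1 := by omega
      have ne_add_one : 2 * u ≠ 2 ^ m * 2 + 1 := by omega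
      rw [← mul_add, Nat.odd_choose_two_mul_two_mul, ih u v (by omega)]
      simp [pow_iff, add_iff, ne_one, ne_add_one]
    · have ne_pow (i : ℕ) : 2 * u + 1 ≠ 2 ^ i * 2 := by omega
      have ne_add (j : ℕ) : 2 * u + 1 ≠ 2 ^ m * 2 + 2 ^ j * 2 := by omega
      rw [show 2 * u + 1 + 2 * v = 2 * (u + v) + 1 by ring,
        Nat.odd_choose_two_mul_add_one_two_mul_add_one,
        Nat.odd_choose_iff_of_two_mul_add_add_one_eq m u v (by omega)]
      simp only [ne_pow, ne_add, and_false, exists_false, or_false]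
      omega

theorem Nat.factorial_div_eq_choose_mul_choose (u v w : ℕ) :
    (u + v + w).factorial / (u.factorial * v.factorial * w.factorial) =
      (u + v + w).choose (u + v) * (u + v).choose u := by
  have h₁ := Nat.add_choose_mul_factorial_mul_factorial (u + v) w
  have h₂ := Nat.add_choose_mul_factorial_mul_factorial u v
  apply Nat.div_eq_of_eq_mul_left (by positivity)
  rw [Nat.choose_symm_add, Nat.choose_symm_add, ← h₁, ← h₂]
  ring

end ChooseParity


/-- Case 2 (`ℓ = 4`): for `3 ≤ s < t`, if `u + v + w = 2^t - 4` and
`(2^s+1)u + (2^(s-1)+1)v + w = 4(2^t-1)`, then `(2^t-4)! / (u!·v!·w!)` is odd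
iff `u = 0`, or `u = 2^i` for some `2 ≤ i ≤ t - s`, or `u = 2^(t-s+1) + 2^j`
for some `2 ≤ j ≤ t - s`. -/
theorem multinomial_odd_iff_case_two
    (s t : ℕ) (hs : 3 ≤ s) (hst : s < t) (u v w : ℕ)
    (h1 : u + v + w = 2 ^ t - 4)
    (h2 : (2 ^ s + 1) * u + (2 ^ (s - 1) + 1) * v + w = 4 * (2 ^ t - 1)) :
    Odd ((2 ^ t - 4).factorial / (u.factorial * v.factorial * w.factorial)) ↔
      (u = 0 ∨ (∃ i : ℕ, 2 ≤ i ∧ i ≤ t - s ∧ u = 2 ^ i) ∨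
        (∃ j : ℕ, 2 ≤ j ∧ j ≤ t - s ∧ u = 2 ^ (t - s + 1) + 2 ^ j)) := by
  obtain ⟨m, rfl⟩ : ∃ m, t = s + m + 1 := ⟨t - s - 1, by omega⟩
  obtain ⟨r, rfl⟩ : ∃ r, s = r + 1 := ⟨s - 1, by omega⟩
  rw [show r + 1 + m + 1 - (r + 1) = m + 1 by omega]
  rw [Nat.add_sub_cancel] at h2
  have ht : 2 ^ (r + 1 + m + 1) = 2 ^ r * 2 ^ (m + 2) := by ring
  have h4 : 4 ≤ 2 ^ (r + 1 + m + 1) := by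
    simpa using Nat.pow_le_pow_right (n := 2) two_pos (show 2 ≤ r + 1 + m + 1 by omega)
  have huv : 2 * u + v = 3 * 2 ^ (m + 2) := by
    apply Nat.eq_of_mul_eq_mul_left (Nat.two_pow_pos r)
    rw [pow_succ 2 r] at h2
    have h3 : 2 ^ r * (2 * u + v) + (u + v + w) = 4 * (2 ^ (r + 1 + m + 1) - 1) := by
      rw [← h2]; ring
    have h5 : 2 ^ r * (3 * 2 ^ (m + 2)) = 3 * 2 ^ (r + 1 + m + 1) := by rw [ht]; ring
    omega
  have four_dvd : 4 ∣ u + v ↔ 4 ∣ u := by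
    rw [pow_add] at huv
    omega
  have four_dvd_pow (i : ℕ) : 4 ∣ 2 ^ i ↔ 2 ≤ i :=
    Nat.pow_dvd_pow_iff_le_right (x := 2) (k := 2) (by norm_num)
  have four_dvd_add (j : ℕ) : 4 ∣ 2 ^ (m + 2) + 2 ^ j ↔ 2 ≤ j := by
    rw [← four_dvd_pow j, Nat.dvd_add_right ((four_dvd_pow _).2 (by omega))]
  rw [← h1, Nat.factorial_div_eq_choose_mul_choose, Nat.odd_mul, h1,
    Nat.odd_choose_two_pow_sub_four_iff _ _ (by omega) (by omega), four_dvd,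
    Nat.odd_choose_iff_of_two_mul_add_eq _ _ _ huv]
  constructor
  · rintro ⟨hu, rfl | ⟨i, hi, rfl⟩ | ⟨j, hj, rfl⟩⟩
    · exact Or.inl rfl
    · exact Or.inr (Or.inl ⟨i, (four_dvd_pow i).1 hu, by omega, rfl⟩)
    · exact Or.inr (Or.inr ⟨j, (four_dvd_add j).1 hu, by omega, rfl⟩)
  · rintro (rfl | ⟨i, hi, him, rfl⟩ | ⟨j, hj, hjm, rfl⟩)
    · simp
    · exact ⟨(four_dvd_pow i).2 hi, Or.inr (Or.inl ⟨i, by omega, rfl⟩)⟩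
    · exact ⟨(four_dvd_add j).2 hj, Or.inr (Or.inr ⟨j, by omega, rfl⟩)⟩
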